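/- arXiv:1905.04512 — 4 statements merged into one kernel-verified Lean document; each statement's English description precedes it below -/
import Mathlib

section
/- On ℝ³ the vector fields X₁ = (−½(2x − 3y − z − 2)(−1 + e^{2x}), (3/2)e^{2x}y + ½e^{2x}z + e^{2x} + y/2 − z/2 − 1 − e^{2x}x − x, −(3/2)e^{2x}y − ½e^{2x}z − e^{2x} + (3/2)y + (5/2)z + 1 + e^{2x}x + y² + 2yz + z² + x), X₂ = (½ − ½e^{2x}, −½e^{2x}, ½e^{2x}), and X₃ = (0, −½, ½) satisfy [X₁, X₂] = −(X₂ + X₃) and [X₁, X₃] = −(X₂ + X₃), so they span a three-dimensional Lie algebra of Bianchi type III. -/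
open Real

/-- The Lie bracket of vector fields on `ℝ³`:
`[X,Y](p) = DY(p)(X(p)) − DX(p)(Y(p))`. -/
noncomputable def lieBr (X Y : (Fin 3 → ℝ) → (Fin 3 → ℝ)) (p : Fin 3 → ℝ) : Fin 3 → ℝ :=
  fderiv ℝ Y p (X p) - fderiv ℝ X p (Y p)

/-- X₁ as in the statement. -/
noncomputable def X₁ : (Fin 3 → ℝ) → (Fin 3 → ℝ) := fun p =>
  ![-(1/2) * (2 * p 0 - 3 * p 1 - p 2 - 2) * (-1 + exp (2 * p 0)),
    (3/2) * exp (2 * p 0) * p 1 + (1/2) * exp (2 * p 0) * p 2 + exp (2 * p 0)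
      + p 1 / 2 - p 2 / 2 - 1 - exp (2 * p 0) * p 0 - p 0,
    -(3/2) * exp (2 * p 0) * p 1 - (1/2) * exp (2 * p 0) * p 2 - exp (2 * p 0)
      + (3/2) * p 1 + (5/2) * p 2 + 1 + exp (2 * p 0) * p 0
      + p 1 ^ 2 + 2 * p 1 * p 2 + p 2 ^ 2 + p 0]

/-- X₂ = (½ − ½e^{2x}, −½e^{2x}, ½e^{2x}). -/
noncomputable def X₂ : (Fin 3 → ℝ) → (Fin 3 → ℝ) := fun p =>
  ![1/2 - (1/2) * exp (2 * p 0), -(1/2) * exp (2 * p 0), (1/2) * exp (2 * p 0)]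

/-- X₃ = (0, −½, ½). -/
noncomputable def X₃ : (Fin 3 → ℝ) → (Fin 3 → ℝ) := fun _ =>
  ![0, -(1/2), 1/2]

theorem fderiv_apply_of_hasDerivAt_line {X : (Fin 3 → ℝ) → (Fin 3 → ℝ)} {p v w : Fin 3 → ℝ}
    (hX : DifferentiableAt ℝ X p)
    (h : ∀ i, HasDerivAt (fun t : ℝ => X (p + t • v) i) (w i) 0) : fderiv ℝ X p v = w := by
  rw [← hX.lineDeriv_eq_fderiv]
  exact HasDerivAt.deriv (hasDerivAt_pi.2 h)

theorem differentiable_X₁ : Differentiable ℝ X₁ := by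
  unfold X₁
  refine differentiable_pi.2 fun i => ?_
  fin_cases i <;> simp <;> fun_prop

theorem differentiable_X₂ : Differentiable ℝ X₂ := by
  unfold X₂
  refine differentiable_pi.2 fun i => ?_
  fin_cases i <;> simp <;> fun_prop

theorem hasDerivAt_line_apply (p v : Fin 3 → ℝ) (i : Fin 3) :
    HasDerivAt (fun t : ℝ => (p + t • v) i) (v i) 0 := by
  simpa using ((hasDerivAt_id (0 : ℝ)).mul_const (v i)).const_add (p i)

theorem hasDerivAt_line_exp (p v : Fin 3 → ℝ) :
    HasDerivAt (fun t : ℝ => exp (2 * (p + t • v) 0)) (exp (2 * p 0) * (2 * v 0)) 0 := by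
  simpa using ((hasDerivAt_line_apply p v 0).const_mul 2).exp

theorem fderiv_X₂ (p v : Fin 3 → ℝ) :
    fderiv ℝ X₂ p v =
      ![-exp (2 * p 0) * v 0, -exp (2 * p 0) * v 0, exp (2 * p 0) * v 0] := by
  refine fderiv_apply_of_hasDerivAt_line (differentiable_X₂ p) fun i => ?_
  have e := hasDerivAt_line_exp p v
  fin_cases i
  · exact ((e.const_mul (1 / 2)).const_sub (1 / 2)).congr_deriv (by simp; ring)
  · exact (e.const_mul (-(1 / 2))).congr_deriv (by simp; ring)
  · exact (e.const_mul (1 / 2)).congr_deriv (by simp; ring)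

theorem fderiv_X₁ (p v : Fin 3 → ℝ) :
    fderiv ℝ X₁ p v =
      ![-(1/2) * (2 * v 0 - 3 * v 1 - v 2) * (-1 + exp (2 * p 0))
          - (2 * p 0 - 3 * p 1 - p 2 - 2) * exp (2 * p 0) * v 0,
        exp (2 * p 0) * (3 * p 1 + p 2 + 1 - 2 * p 0) * v 0 - v 0
          + (3/2 * exp (2 * p 0) + 1/2) * v 1 + (1/2 * exp (2 * p 0) - 1/2) * v 2,
        -exp (2 * p 0) * (3 * p 1 + p 2 + 1 - 2 * p 0) * v 0 + v 0
          + (-(3/2) * exp (2 * p 0) + 3/2 + 2 * (p 1 + p 2)) * v 1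
          + (-(1/2) * exp (2 * p 0) + 5/2 + 2 * (p 1 + p 2)) * v 2] := by
  refine fderiv_apply_of_hasDerivAt_line (differentiable_X₁ p) fun i => ?_
  have e := hasDerivAt_line_exp p v
  have x := hasDerivAt_line_apply p v 0
  have y := hasDerivAt_line_apply p v 1
  have z := hasDerivAt_line_apply p v 2
  fin_cases i
  · exact ((((((x.const_mul 2).sub (y.const_mul 3)).sub z).sub_const 2).const_mul
      (-(1 / 2))).mul (e.const_add (-1))).congr_deriv (by simp; ring)
  · exact ((((((((e.const_mul (3 / 2)).mul y).add ((e.const_mul (1 / 2)).mul z)).add e).add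
      (y.div_const 2)).sub (z.div_const 2)).sub_const 1).sub (e.mul x) |>.sub x).congr_deriv
      (by simp; ring)
  · exact (((((((((((e.const_mul (-(3 / 2))).mul y).sub ((e.const_mul (1 / 2)).mul z)).sub e).add
      (y.const_mul (3 / 2))).add (z.const_mul (5 / 2))).add_const 1).add (e.mul x)).add
      (y.pow 2)).add ((y.const_mul 2).mul z)).add (z.pow 2) |>.add x).congr_deriv
      (by simp; ring)

theorem fderiv_X₃ (p v : Fin 3 → ℝ) : fderiv ℝ X₃ p v = 0 := by
  unfold X₃
  simp

/-- On `ℝ³` the vector fields `X₁, X₂, X₃` satisfy `[X₁, X₂] = −(X₂ + X₃)` and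
`[X₁, X₃] = −(X₂ + X₃)`, so they span a three-dimensional Lie algebra of
Bianchi type III. -/
theorem stmt_9 (p : Fin 3 → ℝ) :
    lieBr X₁ X₂ p = -(X₂ p + X₃ p) ∧
    lieBr X₁ X₃ p = -(X₂ p + X₃ p) := by
  constructor
  · rw [lieBr, fderiv_X₁, fderiv_X₂]
    ext i
    fin_cases i <;> simp [X₁, X₂, X₃] <;> ring
  · rw [lieBr, fderiv_X₁, fderiv_X₃]
    ext i
    fin_cases i <;> simp [X₂, X₃] <;> ring
end

section
/- On ℝ³ the pair (Λ, E) with Λ^{12} = 0, Λ^{13} = −x·e^{x}, Λ^{23} = e^{x}(z − y − 1 + e^{x}) and E = (0, e^{x}, e^{x}(1 − x)) is a Jacobi structure: at every point, (i) Σ_l [Λ^{1l}∂_l Λ^{23} + Λ^{2l}∂_l Λ^{31} + Λ^{3l}∂_l Λ^{12}] + E¹Λ^{23} + E²Λ^{31} + E³Λ^{12} = 0, and (ii) Σ_l E^l ∂_l Λ^{μν} − Σ_l Λ^{lν} ∂_l E^μ − Σ_l Λ^{μl} ∂_l E^ν = 0 for all μ,ν ∈ {1,2,3}. -/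
open Real

/-- Partial derivative `∂_μ f` on `ℝ³`. -/
noncomputable def pd (μ : Fin 3) (f : (Fin 3 → ℝ) → ℝ) (p : Fin 3 → ℝ) : ℝ :=
  fderiv ℝ f p (Pi.single μ 1)

/-- The components `Λ^{μν}` of the bivector with `Λ^{12} = 0`,
`Λ^{13} = −x·e^{x}`, `Λ^{23} = e^{x}(z − y − 1 + e^{x})`, extended
antisymmetrically. -/
noncomputable def L : Fin 3 → Fin 3 → (Fin 3 → ℝ) → ℝ :=
  ![![fun _ => 0,
     fun _ => 0,
     fun p => -(p 0 * exp (p 0))],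
    ![fun _ => 0,
     fun _ => 0,
     fun p => exp (p 0) * (p 2 - p 1 - 1 + exp (p 0))],
    ![fun p => p 0 * exp (p 0),
     fun p => -(exp (p 0) * (p 2 - p 1 - 1 + exp (p 0))),
     fun _ => 0]]

/-- The components of the vector field `E = (0, e^{x}, e^{x}(1 − x))`. -/
noncomputable def E : Fin 3 → (Fin 3 → ℝ) → ℝ :=
  ![fun _ => 0, fun p => exp (p 0), fun p => exp (p 0) * (1 - p 0)]

theorem pd_const (μ : Fin 3) (c : ℝ) (p : Fin 3 → ℝ) : pd μ (fun _ => c) p = 0 := by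
  simp [pd]

theorem pd_neg (μ : Fin 3) (f : (Fin 3 → ℝ) → ℝ) (p : Fin 3 → ℝ) :
    pd μ (fun q => -f q) p = -pd μ f p := by
  simp [pd, fderiv_fun_neg]

theorem pd_coord (μ i : Fin 3) (p : Fin 3 → ℝ) :
    pd μ (fun q => q i) p = (Pi.single μ 1 : Fin 3 → ℝ) i := by
  simp [pd, (hasFDerivAt_apply (𝕜 := ℝ) i p).fderiv]

theorem pd_add (μ : Fin 3) {f g : (Fin 3 → ℝ) → ℝ} {p : Fin 3 → ℝ}
    (hf : DifferentiableAt ℝ f p) (hg : DifferentiableAt ℝ g p) :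
    pd μ (fun q => f q + g q) p = pd μ f p + pd μ g p := by
  simp [pd, fderiv_fun_add hf hg]

theorem pd_sub (μ : Fin 3) {f g : (Fin 3 → ℝ) → ℝ} {p : Fin 3 → ℝ}
    (hf : DifferentiableAt ℝ f p) (hg : DifferentiableAt ℝ g p) :
    pd μ (fun q => f q - g q) p = pd μ f p - pd μ g p := by
  simp [pd, fderiv_fun_sub hf hg]

theorem pd_mul (μ : Fin 3) {f g : (Fin 3 → ℝ) → ℝ} {p : Fin 3 → ℝ}
    (hf : DifferentiableAt ℝ f p) (hg : DifferentiableAt ℝ g p) :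
    pd μ (fun q => f q * g q) p = f p * pd μ g p + g p * pd μ f p := by
  simp [pd, fderiv_fun_mul hf hg]

theorem pd_exp (μ : Fin 3) {f : (Fin 3 → ℝ) → ℝ} {p : Fin 3 → ℝ}
    (hf : DifferentiableAt ℝ f p) :
    pd μ (fun q => exp (f q)) p = exp (f p) * pd μ f p := by
  simp [pd, fderiv_exp hf]

theorem pd_coord_mul_exp (μ : Fin 3) (p : Fin 3 → ℝ) :
    pd μ (fun q => q 0 * exp (q 0)) p
      = (p 0 + 1) * exp (p 0) * (Pi.single μ 1 : Fin 3 → ℝ) 0 := by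
  rw [pd_mul μ (by fun_prop) (by fun_prop), pd_exp μ (by fun_prop), pd_coord]
  ring

theorem pd_exp_mul_one_sub (μ : Fin 3) (p : Fin 3 → ℝ) :
    pd μ (fun q => exp (q 0) * (1 - q 0)) p
      = -(p 0 * exp (p 0)) * (Pi.single μ 1 : Fin 3 → ℝ) 0 := by
  rw [pd_mul μ (by fun_prop) (by fun_prop), pd_exp μ (by fun_prop),
    pd_sub μ (by fun_prop) (by fun_prop), pd_const, pd_coord]
  ring

theorem pd_exp_mul_affine_add_exp (μ : Fin 3) (p : Fin 3 → ℝ) :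
    pd μ (fun q => exp (q 0) * (q 2 - q 1 - 1 + exp (q 0))) p
      = exp (p 0) * ((Pi.single μ 1 : Fin 3 → ℝ) 2 - (Pi.single μ 1 : Fin 3 → ℝ) 1
        + (p 2 - p 1 - 1 + 2 * exp (p 0)) * (Pi.single μ 1 : Fin 3 → ℝ) 0) := by
  rw [pd_mul μ (by fun_prop) (by fun_prop), pd_add μ (by fun_prop) (by fun_prop),
    pd_exp μ (by fun_prop), pd_sub μ (by fun_prop) (by fun_prop),
    pd_sub μ (by fun_prop) (by fun_prop), pd_const, pd_coord, pd_coord, pd_coord]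
  ring

/-- The pair `(Λ, E)` with `Λ^{12} = 0`, `Λ^{13} = −x·e^{x}`,
`Λ^{23} = e^{x}(z − y − 1 + e^{x})`, `E = (0, e^{x}, e^{x}(1 − x))` is a
Jacobi structure on `ℝ³`: (i) the coordinate form of `[Λ,Λ] = 2E∧Λ` and
(ii) the coordinate form of `L_E Λ = 0` hold at every point. -/
theorem stmt_12 (p : Fin 3 → ℝ) :
    ((∑ l : Fin 3, (L 0 l p * pd l (L 1 2) p + L 1 l p * pd l (L 2 0) p
        + L 2 l p * pd l (L 0 1) p))
      + E 0 p * L 1 2 p + E 1 p * L 2 0 p + E 2 p * L 0 1 p = 0) ∧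
    (∀ μ ν : Fin 3,
      (∑ l : Fin 3, E l p * pd l (L μ ν) p)
        - (∑ l : Fin 3, L l ν p * pd l (E μ) p)
        - (∑ l : Fin 3, L μ l p * pd l (E ν) p) = 0) := by
  constructor
  · simp [Fin.sum_univ_three, L, E, pd_const, pd_coord_mul_exp,
      pd_exp_mul_affine_add_exp]
    ring
  · intro μ ν
    fin_cases μ <;> fin_cases ν <;>
      simp [Fin.sum_univ_three, L, E, pd_const, pd_neg, pd_exp, pd_coord, differentiableAt_apply,
        pd_coord_mul_exp, pd_exp_mul_one_sub, pd_exp_mul_affine_add_exp] <;>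
      ring
end

section
/- On the open region U = {(x,y,z) ∈ ℝ³ : x ≠ 0} with the Jacobi structure Λ^{12} = 0, Λ^{13} = −x·e^{x}, Λ^{23} = e^{x}(z − y − 1 + e^{x}), E = (0, e^{x}, e^{x}(1 − x)): the Hamiltonian vector field of f₁ = (2y − z)e^{−x}/x is X₁ = (−1, (y − 1 + e^{x})/x, (2e^{x} + 2y − 2)/x); the Hamiltonian vector field of f₂ = 1 is X₂ = (0, e^{x}, e^{x}(1 − x)); and the Hamiltonian vector field of f₃ = −1/x is X₃ = (0, −e^{x}/x, e^{x}(x − 2)/x). -/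
open Real

/-- The Hamiltonian vector field of `f` with respect to a bivector `Λ` and a
vector field `E` on `ℝ³`: `X_f^ν = Σ_μ (∂_μ f)·Λ^{μν} + f·E^ν`. -/
noncomputable def hamVF (Λ : (Fin 3 → ℝ) → Fin 3 → Fin 3 → ℝ)
    (E : (Fin 3 → ℝ) → Fin 3 → ℝ) (f : (Fin 3 → ℝ) → ℝ) (p : Fin 3 → ℝ) : Fin 3 → ℝ :=
  fun ν => (∑ μ : Fin 3, pd μ f p * Λ p μ ν) + f p * E p ν

/-- The bivector with `Λ^{12} = 0`, `Λ^{13} = −x·e^{x}`,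
`Λ^{23} = e^{x}(z − y − 1 + e^{x})`. -/
noncomputable def Lam : (Fin 3 → ℝ) → Fin 3 → Fin 3 → ℝ := fun p =>
  ![![0, 0, -(p 0 * exp (p 0))],
    ![0, 0, exp (p 0) * (p 2 - p 1 - 1 + exp (p 0))],
    ![p 0 * exp (p 0), -(exp (p 0) * (p 2 - p 1 - 1 + exp (p 0))), 0]]

/-- The Reeb vector field `E = (0, e^{x}, e^{x}(1 − x))`. -/
noncomputable def Evec : (Fin 3 → ℝ) → Fin 3 → ℝ := fun p =>
  ![0, exp (p 0), exp (p 0) * (1 - p 0)]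

/-- Partial derivatives are read off from the Fréchet derivative. -/
theorem HasFDerivAt.pd_eq {f : (Fin 3 → ℝ) → ℝ} {f' : (Fin 3 → ℝ) →L[ℝ] ℝ} {p : Fin 3 → ℝ}
    (h : HasFDerivAt f f' p) (μ : Fin 3) : pd μ f p = f' (Pi.single μ 1) := by
  rw [pd, h.fderiv]

theorem hasFDerivAt_coord (i : Fin 3) (p : Fin 3 → ℝ) :
    HasFDerivAt (fun q : Fin 3 → ℝ => q i)
      (ContinuousLinearMap.proj i : (Fin 3 → ℝ) →L[ℝ] ℝ) p :=
  hasFDerivAt_apply i p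

/-- On `U = {(x,y,z) : x ≠ 0}` with the Jacobi structure `(Λ, E)` above, the
Hamiltonian vector field of `f₁ = (2y − z)e^{−x}/x` is
`X₁ = (−1, (y − 1 + e^{x})/x, (2e^{x} + 2y − 2)/x)`, the Hamiltonian vector
field of `f₂ = 1` is `X₂ = (0, e^{x}, e^{x}(1 − x))`, and the Hamiltonian
vector field of `f₃ = −1/x` is `X₃ = (0, −e^{x}/x, e^{x}(x − 2)/x)`. -/
theorem stmt_14 (p : Fin 3 → ℝ) (hp : p ∈ {q : Fin 3 → ℝ | q 0 ≠ 0}) :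
    hamVF Lam Evec (fun q => (2 * q 1 - q 2) * exp (-q 0) / q 0) p =
      ![-1, (p 1 - 1 + exp (p 0)) / p 0, (2 * exp (p 0) + 2 * p 1 - 2) / p 0] ∧
    hamVF Lam Evec (fun _ => 1) p =
      ![0, exp (p 0), exp (p 0) * (1 - p 0)] ∧
    hamVF Lam Evec (fun q => -(1 / q 0)) p =
      ![0, -(exp (p 0) / p 0), exp (p 0) * (p 0 - 2) / p 0] := by
  have hx : p 0 ≠ 0 := hp
  have hinv : HasFDerivAt (fun q : Fin 3 → ℝ => (q 0)⁻¹) _ p :=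
    (hasDerivAt_inv hx).comp_hasFDerivAt p (hasFDerivAt_coord 0 p)
  have h₁ : HasFDerivAt (fun q : Fin 3 → ℝ => (2 * q 1 - q 2) * exp (-q 0) / q 0) _ p :=
    ((((hasFDerivAt_coord 1 p).const_mul 2).sub (hasFDerivAt_coord 2 p)).mul
      (hasFDerivAt_coord 0 p).neg.exp).mul hinv
  have h₂ : HasFDerivAt (fun _ : Fin 3 → ℝ => (1 : ℝ)) (0 : (Fin 3 → ℝ) →L[ℝ] ℝ) p :=
    hasFDerivAt_const 1 p
  have h₃ : HasFDerivAt (fun q : Fin 3 → ℝ => -(q 0)⁻¹) _ p := hinv.neg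
  refine ⟨?_, ?_, ?_⟩ <;> ext ν
  · simp only [hamVF, h₁.pd_eq]
    fin_cases ν <;>
      simp [Lam, Evec, Fin.sum_univ_three, exp_neg] <;> field_simp <;> ring
  · simp only [hamVF, h₂.pd_eq]
    simp [Evec]
  · simp only [hamVF, one_div, h₃.pd_eq]
    fin_cases ν <;>
      simp [Lam, Evec, Fin.sum_univ_three] <;> field_simp <;> ring
end

section
/- On the open region U = {(x,y,z) ∈ ℝ³ : x ≠ 0} with the Jacobi structure Λ^{12} = 0, Λ^{13} = −x·e^{x}, Λ^{23} = e^{x}(z − y − 1 + e^{x}), E = (0, e^{x}, e^{x}(1 − x)), the functions f₁ = (2y − z)e^{−x}/x, f₂ = 1, f₃ = −1/x satisfy {f₁, f₂} = −f₂ + f₃ and {f₁, f₃} = −f₃ on U, so f₁, f₂, f₃ span a three-dimensional Lie algebra under the Jacobi bracket. -/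
open Real

/-- The Jacobi bracket of `f, g`:
`{f,g} = Σ_{μ,ν} Λ^{μν}·(∂_μ f)·(∂_ν g) + f·(Eg) − g·(Ef)`. -/
noncomputable def jb (Λ : (Fin 3 → ℝ) → Fin 3 → Fin 3 → ℝ)
    (E : (Fin 3 → ℝ) → Fin 3 → ℝ) (f g : (Fin 3 → ℝ) → ℝ) (p : Fin 3 → ℝ) : ℝ :=
  (∑ μ : Fin 3, ∑ ν : Fin 3, Λ p μ ν * pd μ f p * pd ν g p)
    + f p * (∑ μ : Fin 3, E p μ * pd μ g p)
    - g p * (∑ μ : Fin 3, E p μ * pd μ f p)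

/-- f₁ = (2y − z)e^{−x}/x. -/
noncomputable def f₁ : (Fin 3 → ℝ) → ℝ := fun q => (2 * q 1 - q 2) * exp (-q 0) / q 0

/-- f₂ = 1. -/
noncomputable def f₂ : (Fin 3 → ℝ) → ℝ := fun _ => 1

/-- f₃ = −1/x. -/
noncomputable def f₃ : (Fin 3 → ℝ) → ℝ := fun q => -(1 / q 0)

theorem pd_eq_of_hasFDerivAt {f : (Fin 3 → ℝ) → ℝ} {p : Fin 3 → ℝ} {L : (Fin 3 → ℝ) →L[ℝ] ℝ}
    (h : HasFDerivAt f L p) (μ : Fin 3) : pd μ f p = L (Pi.single μ 1) := by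
  rw [pd, h.fderiv]

theorem pd_f₂ (μ : Fin 3) (p : Fin 3 → ℝ) : pd μ f₂ p = 0 :=
  pd_eq_of_hasFDerivAt (hasFDerivAt_const 1 p) μ

theorem pd_f₃ (μ : Fin 3) {p : Fin 3 → ℝ} (hp : p 0 ≠ 0) :
    pd μ f₃ p = (p 0 ^ 2)⁻¹ * (Pi.single μ 1 : Fin 3 → ℝ) 0 := by
  have h0 := hasFDerivAt_apply (𝕜 := ℝ) (0 : Fin 3) p
  have hf : f₃ = -(Inv.inv ∘ fun q : Fin 3 → ℝ => q 0) := by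
    ext q
    simp [f₃]
  have h := ((hasDerivAt_inv hp).comp_hasFDerivAt p h0).neg
  rw [← hf] at h
  simp [pd_eq_of_hasFDerivAt h]

theorem pd_f₁ (μ : Fin 3) {p : Fin 3 → ℝ} (hp : p 0 ≠ 0) (hμ : μ ≠ 0) :
    pd μ f₁ p = (2 * (Pi.single μ 1 : Fin 3 → ℝ) 1 - (Pi.single μ 1 : Fin 3 → ℝ) 2) *
      exp (-p 0) / p 0 := by
  have h0 := hasFDerivAt_apply (𝕜 := ℝ) (0 : Fin 3) p
  have h : HasFDerivAt f₁ _ p :=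
    ((((hasFDerivAt_apply (𝕜 := ℝ) (1 : Fin 3) p).const_mul 2).sub
      (hasFDerivAt_apply (2 : Fin 3) p)).mul h0.neg.exp).mul
      ((hasDerivAt_inv hp).comp_hasFDerivAt p h0)
  simp [pd_eq_of_hasFDerivAt h, Pi.single_eq_of_ne hμ.symm]
  ring

/-- On `U = {(x,y,z) : x ≠ 0}` with the Jacobi structure `(Λ, E)` above, the
functions `f₁ = (2y − z)e^{−x}/x`, `f₂ = 1`, `f₃ = −1/x` satisfy
`{f₁, f₂} = −f₂ + f₃` and `{f₁, f₃} = −f₃`, so `f₁, f₂, f₃` span a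
three-dimensional Lie algebra under the Jacobi bracket. -/
theorem stmt_15 (p : Fin 3 → ℝ) (hp : p ∈ {q : Fin 3 → ℝ | q 0 ≠ 0}) :
    jb Lam Evec f₁ f₂ p = -f₂ p + f₃ p ∧
    jb Lam Evec f₁ f₃ p = -f₃ p := by
  have hx : p 0 ≠ 0 := hp
  have he : exp (-p 0) * exp (p 0) = 1 := by rw [← exp_add]; simp
  have hy : pd 1 f₁ p = 2 * exp (-p 0) / p 0 := by simp [pd_f₁ 1 hx]
  have hz : pd 2 f₁ p = -exp (-p 0) / p 0 := by simp [pd_f₁ 2 hx]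
  constructor
  · simp only [jb, Fin.sum_univ_three, pd_f₂, hy, hz]
    simp [Evec, f₂, f₃]
    field_simp
    linear_combination (-1 - p 0) * he
  · simp only [jb, Fin.sum_univ_three, pd_f₃ _ hx, hy, hz]
    simp [Lam, Evec, f₃]
    field_simp
    linear_combination p 0 * he
end
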